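/- arXiv:2405.16013 — 2 statements merged into one kernel-verified Lean document; each statement's English description precedes it below -/
import Mathlib

section
/- Assume η ∈ P(b,ε). Then the three values sup_{g ∈ Δ_k^n} inf_{z ∈ P(b,ε)} z·log g, inf_{z ∈ P(b,ε)} sup_{g ∈ Δ_k^n} z·log g, and inf_{z ∈ P(b,ε)} z·log z are all equal. Moreover there is a unique z* ∈ P(b,ε) attaining inf_{z ∈ P(b,ε)} z·log z, and this maximum-entropy point z* is also an optimal learner prediction: inf_{z ∈ P(b,ε)} z·log z* = inf_{z ∈ P(b,ε)} z·log z. -/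
open Finset

attribute [local instance] Classical.propDecidable

noncomputable section

/-- The simplex `Δ_k^n`: rows are probability distributions over `Fin k`. -/
def Simplex (n k : ℕ) : Set (Fin n → Fin k → ℝ) :=
  {z | (∀ i ℓ, 0 ≤ z i ℓ) ∧ ∀ i, ∑ ℓ, z i ℓ = 1}

/-- Number of points where rule `j` does not abstain. -/
def nRule {n k p : ℕ} (h : Fin p → Fin n → Option (Fin k)) (j : Fin p) : ℕ :=
  (Finset.univ.filter (fun i => h j i ≠ none)).card

/-- The constraint matrix `A`, with `m = p + k` rows indexed by `Fin p ⊕ Fin k`. -/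
def Amat {n k p : ℕ} (h : Fin p → Fin n → Option (Fin k)) :
    Fin p ⊕ Fin k → Fin n → Fin k → ℝ
  | Sum.inl j => fun i ℓ => if h j i = some ℓ then 1 / (nRule h j : ℝ) else 0
  | Sum.inr ℓ' => fun i ℓ => if ℓ = ℓ' then 1 / (n : ℝ) else 0

/-- `(A z)_j`. -/
def applyA {n k p : ℕ} (h : Fin p → Fin n → Option (Fin k))
    (z : Fin n → Fin k → ℝ) (j : Fin p ⊕ Fin k) : ℝ :=
  ∑ i, ∑ ℓ, Amat h j i ℓ * z i ℓ

/-- The polytope `P(b, ε)`. -/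
def Polytope {n k p : ℕ} (h : Fin p → Fin n → Option (Fin k))
    (b ε : Fin p ⊕ Fin k → ℝ) : Set (Fin n → Fin k → ℝ) :=
  {z | z ∈ Simplex n k ∧ ∀ j, b j - ε j ≤ applyA h z j ∧ applyA h z j ≤ b j + ε j}

/-- Extended-real logarithm, with `elog 0 = ⊥ = -∞`. -/
def elog (x : ℝ) : EReal := if x = 0 then ⊥ else ((Real.log x : ℝ) : EReal)

/-- `z · log g`, valued in `[-∞, 0]` with the convention `0 · log 0 = 0`. -/
def dotlog {n k : ℕ} (z g : Fin n → Fin k → ℝ) : EReal :=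
  ∑ i, ∑ ℓ, (z i ℓ : EReal) * elog (g i ℓ)

/-- `a^{(θ)}_{iℓ} = Σ_j θ_j · A j i ℓ`. -/
def avec {n k p : ℕ} (h : Fin p → Fin n → Option (Fin k))
    (θ : Fin p ⊕ Fin k → ℝ) (i : Fin n) (ℓ : Fin k) : ℝ :=
  ∑ j, θ j * Amat h j i ℓ

/-- The exponential-family (softmax) prediction `g^{(θ)}`. -/
def gexp {n k p : ℕ} (h : Fin p → Fin n → Option (Fin k))
    (θ : Fin p ⊕ Fin k → ℝ) (i : Fin n) (ℓ : Fin k) : ℝ :=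
  Real.exp (avec h θ i ℓ) / ∑ ℓ', Real.exp (avec h θ i ℓ')

/-- The BF dual objective `(σ'−σ)·b − (σ'+σ)·ε − Σ_i log(Σ_ℓ exp(a^{(σ'−σ)}_{iℓ}))`. -/
def dualObj {n k p : ℕ} (h : Fin p → Fin n → Option (Fin k))
    (b ε σ σ' : Fin p ⊕ Fin k → ℝ) : ℝ :=
  (∑ j, (σ' j - σ j) * b j) - (∑ j, (σ' j + σ j) * ε j)
    - ∑ i, Real.log (∑ ℓ, Real.exp (avec h (fun j => σ' j - σ j) i ℓ))

/-- KL summand `a·log(a/c)`, with `0·log(0/c) = 0` and `a·log(a/0) = ⊤` for `a ≠ 0`. -/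
def klTerm (a c : ℝ) : EReal :=
  if a = 0 then 0 else if c = 0 then ⊤ else ((a * Real.log (a / c) : ℝ) : EReal)

/-- `d(μ, ν)`, the summed KL divergences, valued in `[0, +∞]`. -/
def dKL {n k : ℕ} (μ ν : Fin n → Fin k → ℝ) : EReal :=
  ∑ i, ∑ ℓ, klTerm (μ i ℓ) (ν i ℓ)

/-- Unnormalized one-coin Dawid–Skene score `N_{iℓ}`. -/
def Nds {n k p : ℕ} (h : Fin p → Fin n → Option (Fin k))
    (w : Fin k → ℝ) (β : Fin p → ℝ) (i : Fin n) (ℓ : Fin k) : ℝ :=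
  w ℓ * (∏ j ∈ Finset.univ.filter (fun j => h j i = some ℓ), β j)
    * ∏ j ∈ Finset.univ.filter (fun j => ∃ ℓ' ≠ ℓ, h j i = some ℓ'),
        (1 - β j) / ((k : ℝ) - 1)

/-- The one-coin Dawid–Skene prediction `g^{ds}(w, β)`. -/
def gds {n k p : ℕ} (h : Fin p → Fin n → Option (Fin k))
    (w : Fin k → ℝ) (β : Fin p → ℝ) (i : Fin n) (ℓ : Fin k) : ℝ :=
  Nds h w β i ℓ / ∑ ℓ', Nds h w β i ℓ'

/-- The real number underlying `dotlog z g` when the support of `z` lies in that of `g`. -/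
def realDotlog {n k : ℕ} (z g : Fin n → Fin k → ℝ) : ℝ :=
  ∑ i, ∑ ℓ, z i ℓ * Real.log (g i ℓ)

lemma EReal.coe_finset_sum {ι : Type*} (s : Finset ι) (f : ι → ℝ) :
    ((∑ i ∈ s, f i : ℝ) : EReal) = ∑ i ∈ s, (f i : EReal) := by
  induction s using Finset.induction_on with
  | empty => simp
  | insert a s ha ih => rw [Finset.sum_insert ha, Finset.sum_insert ha, EReal.coe_add, ih]

lemma EReal.finset_sum_ne_top {ι : Type*} (s : Finset ι) {f : ι → EReal}
    (hf : ∀ i ∈ s, f i ≠ ⊤) : ∑ i ∈ s, f i ≠ ⊤ := by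
  induction s using Finset.induction_on with
  | empty => simp
  | insert a s ha ih =>
    rw [Finset.sum_insert ha]
    exact EReal.add_ne_top (hf a (Finset.mem_insert_self a s))
      (ih fun i hi => hf i (Finset.mem_insert_of_mem hi))

lemma EReal.finset_sum_eq_bot {ι : Type*} {s : Finset ι} {f : ι → EReal} {i : ι}
    (hi : i ∈ s) (hf : f i = ⊥) : ∑ i ∈ s, f i = ⊥ := by
  rw [← Finset.add_sum_erase s f hi, hf, EReal.bot_add]

lemma EReal.tendsto_finset_sum {ι α : Type*} {l : Filter α} (s : Finset ι)
    {f : ι → α → EReal} {a : ι → EReal} (ha : ∀ i ∈ s, a i ≠ ⊤)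
    (hf : ∀ i ∈ s, Filter.Tendsto (f i) l (nhds (a i))) :
    Filter.Tendsto (fun x => ∑ i ∈ s, f i x) l (nhds (∑ i ∈ s, a i)) := by
  induction s using Finset.induction_on with
  | empty => simpa using tendsto_const_nhds
  | insert j s hj ih =>
    simp only [Finset.sum_insert hj]
    have hs : ∀ i ∈ s, i ∈ insert j s := fun i hi => Finset.mem_insert_of_mem hi
    have hj' := ha j (Finset.mem_insert_self j s)
    have hsum : ∑ i ∈ s, a i ≠ ⊤ := EReal.finset_sum_ne_top s fun i hi => ha i (hs i hi)
    exact (EReal.continuousAt_add (p := (a j, ∑ i ∈ s, a i)) (Or.inl hj') (Or.inr hsum)).tendsto.comp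
      ((hf j (Finset.mem_insert_self j s)).prodMk_nhds
        (ih (fun i hi => ha i (hs i hi)) fun i hi => hf i (hs i hi)))

lemma elog_eq_log_ofReal {x : ℝ} (hx : 0 ≤ x) : elog x = ENNReal.log (ENNReal.ofReal x) := by
  rcases hx.eq_or_lt with rfl | hx
  · simp [elog]
  · rw [ENNReal.log_ofReal_of_pos hx, elog, if_neg hx.ne']

lemma elog_ne_top (x : ℝ) : elog x ≠ ⊤ := by
  unfold elog
  split_ifs <;> simp

lemma coe_mul_elog {x y : ℝ} (h : y = 0 → x = 0) :
    (x : EReal) * elog y = ((x * Real.log y : ℝ) : EReal) := by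
  by_cases hy : y = 0
  · simp [h hy]
  · rw [elog, if_neg hy, EReal.coe_mul]

lemma coe_mul_elog_eq_bot {x : ℝ} (hx : 0 < x) : (x : EReal) * elog 0 = ⊥ := by
  rw [elog, if_pos rfl, EReal.coe_mul_bot_of_pos hx]

lemma coe_mul_elog_ne_top {x : ℝ} (hx : 0 ≤ x) (y : ℝ) : (x : EReal) * elog y ≠ ⊤ := by
  by_cases h : y = 0 → x = 0
  · rw [coe_mul_elog h]
    exact EReal.coe_ne_top _
  · push Not at h
    rw [h.1, coe_mul_elog_eq_bot (hx.lt_of_ne' h.2)]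
    exact bot_ne_top

lemma tendsto_elog {α : Type*} {l : Filter α} {f : α → ℝ} {a : ℝ} (ha : 0 ≤ a)
    (hf : Filter.Tendsto f l (nhds a)) (hpos : ∀ᶠ x in l, 0 ≤ f x) :
    Filter.Tendsto (fun x => elog (f x)) l (nhds (elog a)) := by
  rw [elog_eq_log_ofReal ha]
  refine Filter.Tendsto.congr' ?_
    ((ENNReal.continuous_log.tendsto _).comp (ENNReal.tendsto_ofReal hf))
  filter_upwards [hpos] with x hx
  exact (elog_eq_log_ofReal hx).symm

lemma mul_log_lt_mul_log_add {x y : ℝ} (hx : 0 ≤ x) (hy : 0 ≤ y) (h : y = 0 → x = 0)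
    (hne : x ≠ y) : x * Real.log y < x * Real.log x + (y - x) := by
  have hy' : 0 < y := hy.lt_of_ne' fun h0 => hne (by rw [h h0, h0])
  rcases hx.eq_or_lt with rfl | hx
  · simpa using hy'
  · have h1 := Real.log_lt_sub_one_of_pos (div_pos hy' hx)
      (fun h1 => hne ((div_eq_one_iff_eq hx.ne').1 h1).symm)
    rw [Real.log_div hy'.ne' hx.ne'] at h1
    have h2 := mul_lt_mul_of_pos_left h1 hx
    have h3 : x * (y / x - 1) = y - x := by field_simp
    linarith

lemma mul_log_le_mul_log_add {x y : ℝ} (hx : 0 ≤ x) (hy : 0 ≤ y) (h : y = 0 → x = 0) :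
    x * Real.log y ≤ x * Real.log x + (y - x) := by
  rcases eq_or_ne x y with rfl | hne
  · simp
  · exact (mul_log_lt_mul_log_add hx hy h hne).le

section Dotlog

variable {n k : ℕ} {z g : Fin n → Fin k → ℝ}

lemma dotlog_eq_coe (h : ∀ i ℓ, g i ℓ = 0 → z i ℓ = 0) : dotlog z g = (realDotlog z g : EReal) := by
  simp only [dotlog, realDotlog, EReal.coe_finset_sum]
  exact Finset.sum_congr rfl fun i _ => Finset.sum_congr rfl fun ℓ _ => coe_mul_elog (h i ℓ)

lemma dotlog_self (z : Fin n → Fin k → ℝ) : dotlog z z = (realDotlog z z : EReal) :=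
  dotlog_eq_coe fun _ _ h => h

lemma dotlog_eq_bot (hz : z ∈ Simplex n k) (h : ¬ ∀ i ℓ, g i ℓ = 0 → z i ℓ = 0) :
    dotlog z g = ⊥ := by
  push Not at h
  obtain ⟨i, ℓ, hg, hne⟩ := h
  refine EReal.finset_sum_eq_bot (Finset.mem_univ i)
    (EReal.finset_sum_eq_bot (Finset.mem_univ ℓ) ?_)
  rw [hg, coe_mul_elog_eq_bot ((hz.1 i ℓ).lt_of_ne' hne)]

lemma sum_sum_log_add_sub (hz : z ∈ Simplex n k) (hg : g ∈ Simplex n k) :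
    ∑ i, ∑ ℓ, (z i ℓ * Real.log (z i ℓ) + (g i ℓ - z i ℓ)) = realDotlog z z := by
  simp [realDotlog, Finset.sum_add_distrib, Finset.sum_sub_distrib, hz.2, hg.2]

/-- Gibbs' inequality. -/
lemma realDotlog_le_self (hz : z ∈ Simplex n k) (hg : g ∈ Simplex n k)
    (h : ∀ i ℓ, g i ℓ = 0 → z i ℓ = 0) : realDotlog z g ≤ realDotlog z z := by
  rw [← sum_sum_log_add_sub hz hg]
  exact Finset.sum_le_sum fun i _ => Finset.sum_le_sum fun ℓ _ =>
    mul_log_le_mul_log_add (hz.1 i ℓ) (hg.1 i ℓ) (h i ℓ)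

/-- Strict Gibbs' inequality. -/
lemma realDotlog_lt_self (hz : z ∈ Simplex n k) (hg : g ∈ Simplex n k)
    (h : ∀ i ℓ, g i ℓ = 0 → z i ℓ = 0) (hne : z ≠ g) : realDotlog z g < realDotlog z z := by
  obtain ⟨i, hi⟩ := Function.ne_iff.1 hne
  obtain ⟨ℓ, hℓ⟩ := Function.ne_iff.1 hi
  rw [← sum_sum_log_add_sub hz hg]
  have hle : ∀ i ℓ, z i ℓ * Real.log (g i ℓ) ≤ z i ℓ * Real.log (z i ℓ) + (g i ℓ - z i ℓ) :=
    fun i ℓ => mul_log_le_mul_log_add (hz.1 i ℓ) (hg.1 i ℓ) (h i ℓ)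
  exact Finset.sum_lt_sum (fun i _ => Finset.sum_le_sum fun ℓ _ => hle i ℓ)
    ⟨i, Finset.mem_univ i, Finset.sum_lt_sum (fun ℓ _ => hle i ℓ)
      ⟨ℓ, Finset.mem_univ ℓ, mul_log_lt_mul_log_add (hz.1 i ℓ) (hg.1 i ℓ) (h i ℓ) hℓ⟩⟩

lemma dotlog_le_self (hz : z ∈ Simplex n k) (hg : g ∈ Simplex n k) :
    dotlog z g ≤ dotlog z z := by
  by_cases h : ∀ i ℓ, g i ℓ = 0 → z i ℓ = 0
  · rw [dotlog_eq_coe h, dotlog_self]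
    exact EReal.coe_le_coe_iff.2 (realDotlog_le_self hz hg h)
  · rw [dotlog_eq_bot hz h]
    exact bot_le

lemma eq_of_dotlog_self_le (hz : z ∈ Simplex n k) (hg : g ∈ Simplex n k)
    (hle : dotlog z z ≤ dotlog z g) : z = g := by
  by_contra hne
  by_cases h : ∀ i ℓ, g i ℓ = 0 → z i ℓ = 0
  · rw [dotlog_eq_coe h, dotlog_self, EReal.coe_le_coe_iff] at hle
    exact (realDotlog_lt_self hz hg h hne).not_ge hle
  · rw [dotlog_eq_bot hz h, dotlog_self, le_bot_iff] at hle
    exact EReal.coe_ne_bot _ hle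

lemma iSup_dotlog (hz : z ∈ Simplex n k) : ⨆ g ∈ Simplex n k, dotlog z g = dotlog z z :=
  le_antisymm (iSup₂_le fun _ hg => dotlog_le_self hz hg)
    (le_iSup₂ (f := fun g (_ : g ∈ Simplex n k) => dotlog z g) z hz)

lemma tendsto_dotlog {α : Type*} {l : Filter α} {f : α → Fin n → Fin k → ℝ}
    (hz : z ∈ Simplex n k) (hg : g ∈ Simplex n k) (hf : Filter.Tendsto f l (nhds g))
    (hmem : ∀ᶠ x in l, f x ∈ Simplex n k) :
    Filter.Tendsto (fun x => dotlog z (f x)) l (nhds (dotlog z g)) := by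
  refine EReal.tendsto_finset_sum _ (fun i _ => EReal.finset_sum_ne_top _ fun ℓ _ =>
    coe_mul_elog_ne_top (hz.1 i ℓ) _) fun i _ => EReal.tendsto_finset_sum _
    (fun ℓ _ => coe_mul_elog_ne_top (hz.1 i ℓ) _) fun ℓ _ => ?_
  have h1 : Filter.Tendsto (fun x => f x i ℓ) l (nhds (g i ℓ)) :=
    tendsto_pi_nhds.1 (tendsto_pi_nhds.1 hf i) ℓ
  exact EReal.Tendsto.const_mul (tendsto_elog (hg.1 i ℓ) h1 (hmem.mono fun x hx => hx.1 i ℓ))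
    (Or.inl (EReal.coe_ne_bot _)) (Or.inl (EReal.coe_ne_top _))

lemma continuous_realDotlog_self :
    Continuous fun z : Fin n → Fin k → ℝ => realDotlog z z := by
  unfold realDotlog
  refine continuous_finsetSum _ fun i _ => continuous_finsetSum _ fun ℓ _ => ?_
  exact Real.continuous_mul_log.comp ((continuous_apply ℓ).comp (continuous_apply i))

lemma convex_simplex : Convex ℝ (Simplex n k) := by
  intro x hx y hy a c ha hc hac
  refine ⟨fun i ℓ => ?_, fun i => ?_⟩
  · exact add_nonneg (mul_nonneg ha (hx.1 i ℓ)) (mul_nonneg hc (hy.1 i ℓ))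
  · simp [Finset.sum_add_distrib, ← Finset.mul_sum, hx.2, hy.2, hac]

lemma isCompact_simplex : IsCompact (Simplex n k) := by
  refine (isCompact_Icc (a := (0 : Fin n → Fin k → ℝ)) (b := 1)).of_isClosed_subset ?_ ?_
  · have heq : Simplex n k = (⋂ i, ⋂ ℓ, {z | 0 ≤ z i ℓ}) ∩ ⋂ i, {z | ∑ ℓ, z i ℓ = 1} := by
      ext z
      simp [Simplex]
    rw [heq]
    exact (isClosed_iInter fun i => isClosed_iInter fun ℓ =>
      isClosed_le continuous_const (by fun_prop)).inter
      (isClosed_iInter fun i => isClosed_eq (by fun_prop) continuous_const)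
  · exact fun z hz => ⟨fun i ℓ => hz.1 i ℓ, fun i ℓ =>
      (Finset.single_le_sum (fun ℓ _ => hz.1 i ℓ) (Finset.mem_univ ℓ)).trans_eq (hz.2 i)⟩

/-- A minimizer of `z · log z` over a convex set of predictions is an optimal learner prediction
against that set. -/
lemma dotlog_self_le_of_isMinOn {K : Set (Fin n → Fin k → ℝ)} (hK : Convex ℝ K)
    (hsub : K ⊆ Simplex n k) {x : Fin n → Fin k → ℝ} (hx : x ∈ K)
    (hmin : ∀ y ∈ K, realDotlog x x ≤ realDotlog y y) (hz : z ∈ K) :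
    dotlog x x ≤ dotlog z x := by
  let w : ℝ → Fin n → Fin k → ℝ := fun t => (1 - t) • x + t • z
  have hw : ∀ t ∈ Set.Ioo (0 : ℝ) 1, w t ∈ K := fun t ht =>
    hK hx hz (sub_nonneg.2 ht.2.le) ht.1.le (by ring)
  have hev : ∀ᶠ t in nhdsWithin (0 : ℝ) (Set.Ioi 0), t ∈ Set.Ioo (0 : ℝ) 1 :=
    Ioo_mem_nhdsGT one_pos
  have hlim : Filter.Tendsto w (nhdsWithin (0 : ℝ) (Set.Ioi 0)) (nhds x) := by
    have hc : Continuous w := by fun_prop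
    have h0 := hc.tendsto 0
    simp only [w, sub_zero, one_smul, zero_smul, add_zero] at h0
    exact h0.mono_left nhdsWithin_le_nhds
  refine ge_of_tendsto (tendsto_dotlog (hsub hz) (hsub hx) hlim
    (hev.mono fun t ht => hsub (hw t ht))) (hev.mono fun t ht => ?_)
  have ht1 : 0 < 1 - t := sub_pos.2 ht.2
  have hsupp : ∀ i ℓ, w t i ℓ = 0 → x i ℓ = 0 ∧ z i ℓ = 0 := by
    intro i ℓ h
    have h1 := (add_eq_zero_iff_of_nonneg (mul_nonneg ht1.le ((hsub hx).1 i ℓ))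
      (mul_nonneg ht.1.le ((hsub hz).1 i ℓ))).1 h
    exact ⟨(mul_eq_zero.1 h1.1).resolve_left ht1.ne', (mul_eq_zero.1 h1.2).resolve_left ht.1.ne'⟩
  rw [dotlog_self, dotlog_eq_coe fun i ℓ h => (hsupp i ℓ h).2, EReal.coe_le_coe_iff]
  have hgibbs : realDotlog x (w t) ≤ realDotlog x x :=
    realDotlog_le_self (hsub hx) (hsub (hw t ht)) fun i ℓ h => (hsupp i ℓ h).1
  have hexp : realDotlog (w t) (w t) = (1 - t) * realDotlog x (w t) + t * realDotlog z (w t) := by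
    simp only [realDotlog, Finset.mul_sum, ← Finset.sum_add_distrib]
    refine Finset.sum_congr rfl fun i _ => Finset.sum_congr rfl fun ℓ _ => ?_
    have : w t i ℓ = (1 - t) * x i ℓ + t * z i ℓ := rfl
    linear_combination Real.log (w t i ℓ) * this
  have h1 := hmin _ (hw t ht)
  have h2 := mul_le_mul_of_nonneg_left hgibbs ht1.le
  refine le_of_mul_le_mul_left ?_ ht.1
  linarith

end Dotlog

section Polytope

variable {n k p : ℕ} (h : Fin p → Fin n → Option (Fin k)) (b ε : Fin p ⊕ Fin k → ℝ)

lemma convex_polytope : Convex ℝ (Polytope h b ε) := by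
  intro x hx y hy a c ha hc hac
  refine ⟨convex_simplex hx.1 hy.1 ha hc hac, fun j => ?_⟩
  have hA : applyA h (a • x + c • y) j = a • applyA h x j + c • applyA h y j := by
    simp only [applyA, smul_eq_mul, Finset.mul_sum, ← Finset.sum_add_distrib]
    refine Finset.sum_congr rfl fun i _ => Finset.sum_congr rfl fun ℓ _ => ?_
    simp only [Pi.add_apply, Pi.smul_apply, smul_eq_mul]
    ring
  rw [hA]
  exact convex_Icc (b j - ε j) (b j + ε j) (hx.2 j) (hy.2 j) ha hc hac

lemma isCompact_polytope : IsCompact (Polytope h b ε) := by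
  have heq : Polytope h b ε
      = Simplex n k ∩ ⋂ j, {z | b j - ε j ≤ applyA h z j ∧ applyA h z j ≤ b j + ε j} := by
    ext z
    simp only [Polytope, Set.mem_inter_iff, Set.mem_iInter, Set.mem_ofPred_eq]
  have hcont : ∀ j, Continuous fun z => applyA h z j := fun j => by
    unfold applyA
    fun_prop
  rw [heq]
  exact isCompact_simplex.inter_right <| isClosed_iInter fun j =>
    (isClosed_le continuous_const (hcont j)).inter (isClosed_le (hcont j) continuous_const)

end Polytope

/-- minimax equalities, existence and uniqueness of the maximum-entropy
point `z*` of `P(b,ε)`, and optimality of `z*` as a learner prediction. -/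
theorem stmt0 {n k p : ℕ} (hn : 0 < n) (hk : 2 ≤ k) (hp : 0 < p)
    (h : Fin p → Fin n → Option (Fin k)) (hnj : ∀ j, 0 < nRule h j)
    (η : Fin n → Fin k → ℝ) (b ε : Fin p ⊕ Fin k → ℝ)
    (hmem : η ∈ Polytope h b ε) :
    (⨆ g ∈ Simplex n k, ⨅ z ∈ Polytope h b ε, dotlog z g)
        = (⨅ z ∈ Polytope h b ε, ⨆ g ∈ Simplex n k, dotlog z g)
    ∧ (⨅ z ∈ Polytope h b ε, ⨆ g ∈ Simplex n k, dotlog z g)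
        = (⨅ z ∈ Polytope h b ε, dotlog z z)
    ∧ ∃ zstar ∈ Polytope h b ε,
        dotlog zstar zstar = (⨅ z ∈ Polytope h b ε, dotlog z z)
        ∧ (∀ z' ∈ Polytope h b ε,
            dotlog z' z' = (⨅ z ∈ Polytope h b ε, dotlog z z) → z' = zstar)
        ∧ (⨅ z ∈ Polytope h b ε, dotlog z zstar)
            = (⨅ z ∈ Polytope h b ε, dotlog z z) := by
  have hsub : Polytope h b ε ⊆ Simplex n k := fun z hz => hz.1
  obtain ⟨x, hx, hmin⟩ := (isCompact_polytope h b ε).exists_isMinOn ⟨η, hmem⟩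
    continuous_realDotlog_self.continuousOn
  have hopt : ∀ z ∈ Polytope h b ε, dotlog x x ≤ dotlog z x := fun z hz =>
    dotlog_self_le_of_isMinOn (convex_polytope h b ε) hsub hx (fun y hy => hmin hy) hz
  have hval : (⨅ z ∈ Polytope h b ε, dotlog z x) = dotlog x x :=
    le_antisymm (iInf₂_le x hx) (le_iInf₂ hopt)
  have hent : (⨅ z ∈ Polytope h b ε, dotlog z z) = dotlog x x :=
    le_antisymm (iInf₂_le x hx) (le_iInf₂ fun z hz =>
      (hopt z hz).trans (dotlog_le_self (hsub hz) (hsub hx)))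
  have hsup : (⨅ z ∈ Polytope h b ε, ⨆ g ∈ Simplex n k, dotlog z g)
      = ⨅ z ∈ Polytope h b ε, dotlog z z :=
    iInf_congr fun z => iInf_congr fun hz => iSup_dotlog (hsub hz)
  refine ⟨le_antisymm ?_ ?_, hsup, x, hx, hent.symm, fun z hz hzval => ?_, hval.trans hent.symm⟩
  · exact iSup₂_le fun g hg => iInf₂_mono fun z _ =>
      le_iSup₂ (f := fun g (_ : g ∈ Simplex n k) => dotlog z g) g hg
  · rw [hsup, hent, ← hval]
    exact le_iSup₂ (f := fun g (_ : g ∈ Simplex n k) => ⨅ z ∈ Polytope h b ε, dotlog z g)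
      x (hsub hx)
  · exact eq_of_dotlog_self_le (hsub hz) (hsub hx) ((hzval.trans hent).le.trans (hopt z hz))
end
end

section
/- (𝒢 equals the set of interior one-coin Dawid–Skene predictions.) The exponential family 𝒢 coincides, as a subset of Δ_k^n, with the set { g^{ds}(w,β) : w : Fin k → ℝ, β : Fin p → ℝ, 0 < w_ℓ < 1 for all ℓ, Σ_ℓ w_ℓ = 1, 0 < β_j < 1 for all j }. -/
open Finset

attribute [local instance] Classical.propDecidable

noncomputable section

/-- If the weights and accuracies match the natural parameters `θ`, the Dawid–Skene score is
proportional, within each row, to the exponential score. -/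
theorem Nds_eq_mul_exp_avec {n k p : ℕ} (h : Fin p → Fin n → Option (Fin k))
    (θ : Fin p ⊕ Fin k → ℝ) (w : Fin k → ℝ) (β : Fin p → ℝ) (D : ℝ)
    (hw : ∀ ℓ, w ℓ = D * Real.exp (θ (Sum.inr ℓ) * (1 / (n : ℝ))))
    (hβ : ∀ j, β j = (1 - β j) / ((k : ℝ) - 1)
      * Real.exp (θ (Sum.inl j) * (1 / (nRule h j : ℝ))))
    (i : Fin n) (ℓ : Fin k) :
    Nds h w β i ℓ = (D * ∏ j, if h j i = none then 1 else (1 - β j) / ((k : ℝ) - 1))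
      * Real.exp (avec h θ i ℓ) := by
  have hprod : (∏ j ∈ Finset.univ.filter (fun j => h j i = some ℓ), β j)
      * ∏ j ∈ Finset.univ.filter (fun j => ∃ ℓ' ≠ ℓ, h j i = some ℓ'),
        (1 - β j) / ((k : ℝ) - 1)
      = (∏ j, if h j i = none then 1 else (1 - β j) / ((k : ℝ) - 1))
        * ∏ j, Real.exp (θ (Sum.inl j) * Amat h (Sum.inl j) i ℓ) := by
    rw [Finset.prod_filter, Finset.prod_filter, ← Finset.prod_mul_distrib,
      ← Finset.prod_mul_distrib]
    refine Finset.prod_congr rfl fun j _ => ?_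
    rcases hj : h j i with _ | x
    · simp [Amat, hj]
    · by_cases hx : x = ℓ
      · subst hx
        simpa [Amat, hj] using hβ j
      · simp [Amat, hj, hx]
  have hclass : ∑ ℓ', θ (Sum.inr ℓ') * Amat h (Sum.inr ℓ') i ℓ
      = θ (Sum.inr ℓ) * (1 / (n : ℝ)) := by
    simp [Amat]
  rw [Nds, mul_assoc, hprod, hw, avec, Fintype.sum_sum_type, Real.exp_add, hclass,
    Real.exp_sum]
  ring

/-- Under the same matching of parameters, the two normalized predictions agree. -/
theorem gexp_eq_gds {n k p : ℕ} (hk : 2 ≤ k) (h : Fin p → Fin n → Option (Fin k))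
    (θ : Fin p ⊕ Fin k → ℝ) (w : Fin k → ℝ) (β : Fin p → ℝ) (D : ℝ) (hD : D ≠ 0)
    (hβ1 : ∀ j, β j < 1)
    (hw : ∀ ℓ, w ℓ = D * Real.exp (θ (Sum.inr ℓ) * (1 / (n : ℝ))))
    (hβ : ∀ j, β j = (1 - β j) / ((k : ℝ) - 1)
      * Real.exp (θ (Sum.inl j) * (1 / (nRule h j : ℝ)))) :
    gexp h θ = gds h w β := by
  have hk1 : (k : ℝ) - 1 ≠ 0 := by
    have : (2 : ℝ) ≤ k := by exact_mod_cast hk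
    linarith
  funext i ℓ
  have hc : (D * ∏ j, if h j i = none then 1 else (1 - β j) / ((k : ℝ) - 1)) ≠ 0 := by
    refine mul_ne_zero hD (Finset.prod_ne_zero_iff.2 fun j _ => ?_)
    split_ifs
    · exact one_ne_zero
    · exact div_ne_zero (sub_pos.2 (hβ1 j)).ne' hk1
  simp only [gexp, gds, Nds_eq_mul_exp_avec h θ w β D hw hβ, ← Finset.mul_sum]
  rw [mul_div_mul_left _ _ hc]

/-- the exponential family `𝒢` coincides with the set of interior
one-coin Dawid–Skene predictions. -/
theorem stmt11 {n k p : ℕ} (hn : 0 < n) (hk : 2 ≤ k) (hp : 0 < p)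
    (h : Fin p → Fin n → Option (Fin k)) (hnj : ∀ j, 0 < nRule h j) :
    {g : Fin n → Fin k → ℝ | ∃ θ : Fin p ⊕ Fin k → ℝ, g = gexp h θ}
      = {g : Fin n → Fin k → ℝ | ∃ (w : Fin k → ℝ) (β : Fin p → ℝ),
          (∀ ℓ, 0 < w ℓ ∧ w ℓ < 1) ∧ (∑ ℓ, w ℓ) = 1 ∧ (∀ j, 0 < β j ∧ β j < 1)
          ∧ g = gds h w β} := by
  have hk1 : (0 : ℝ) < (k : ℝ) - 1 := by
    have : (2 : ℝ) ≤ k := by exact_mod_cast hk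
    linarith
  have hn0 : (n : ℝ) ≠ 0 := by exact_mod_cast hn.ne'
  have hnj0 : ∀ j, (nRule h j : ℝ) ≠ 0 := fun j => by exact_mod_cast (hnj j).ne'
  ext g
  constructor
  · rintro ⟨θ, rfl⟩
    set e : Fin k → ℝ := fun ℓ => Real.exp (θ (Sum.inr ℓ) * (1 / (n : ℝ)))
    set r : Fin p → ℝ := fun j => Real.exp (θ (Sum.inl j) * (1 / (nRule h j : ℝ)))
    have he0 : ∀ ℓ, 0 < e ℓ := fun ℓ => Real.exp_pos _
    have hr0 : ∀ j, 0 < r j := fun j => Real.exp_pos _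
    have hlt : ∀ ℓ, e ℓ < ∑ ℓ', e ℓ' := fun ℓ => by
      have : Nontrivial (Fin k) := Fin.nontrivial_iff_two_le.2 hk
      obtain ⟨ℓ', hℓ'⟩ := exists_ne ℓ
      exact Finset.single_lt_sum hℓ' (Finset.mem_univ _) (Finset.mem_univ _) (he0 ℓ')
        fun x _ _ => (he0 x).le
    have hS : 0 < ∑ ℓ', e ℓ' := (he0 ⟨0, by omega⟩).trans (hlt _)
    have hβ1 : ∀ j, r j / (r j + ((k : ℝ) - 1)) < 1 := fun j => by
      rw [div_lt_one (add_pos (hr0 j) hk1)]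
      linarith
    refine ⟨fun ℓ => e ℓ / ∑ ℓ', e ℓ', fun j => r j / (r j + ((k : ℝ) - 1)),
      fun ℓ => ⟨div_pos (he0 ℓ) hS, (div_lt_one hS).2 (hlt ℓ)⟩, ?_,
      fun j => ⟨div_pos (hr0 j) (add_pos (hr0 j) hk1), hβ1 j⟩,
      gexp_eq_gds hk h θ _ _ (∑ ℓ', e ℓ')⁻¹ (inv_ne_zero hS.ne') hβ1
        (fun ℓ => div_eq_inv_mul _ _) fun j => ?_⟩
    · rw [← Finset.sum_div, div_self hS.ne']
    · change r j / (r j + ((k : ℝ) - 1))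
        = (1 - r j / (r j + ((k : ℝ) - 1))) / ((k : ℝ) - 1) * r j
      have hne := (add_pos (hr0 j) hk1).ne'
      have hk0 := hk1.ne'
      rw [one_sub_div hne, add_sub_cancel_left, div_right_comm, div_self hk0]
      ring
  · rintro ⟨w, β, hw, -, hβ, rfl⟩
    refine ⟨Sum.elim (fun j => nRule h j * Real.log (β j * ((k : ℝ) - 1) / (1 - β j)))
      (fun ℓ => n * Real.log (w ℓ)), (gexp_eq_gds hk h _ w β 1 one_ne_zero
        (fun j => (hβ j).2) (fun ℓ => ?_) fun j => ?_).symm⟩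
    · rw [Sum.elim_inr, mul_one_div, mul_div_cancel_left₀ _ hn0, Real.exp_log (hw ℓ).1, one_mul]
    · have hβ1 : 0 < 1 - β j := sub_pos.2 (hβ j).2
      rw [Sum.elim_inl, mul_one_div, mul_div_cancel_left₀ _ (hnj0 j),
        Real.exp_log (div_pos (mul_pos (hβ j).1 hk1) hβ1)]
      field_simp
end
end
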